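/- Let U ⊆ ℝ³ be open, let p = (a, a, c) ∈ U be a point on the diagonal {x₁ = x₂}, and let F : U → ℝ be twice continuously differentiable such that, in addition, the partial derivatives of F with respect to the second variable up to order 5 exist and are continuous on U. Assume ∂F/∂x₂(p) = 0 and ∂³F/∂x₂³(p) = 0. Define h(ε) := F(a, a + √ε, c) for ε ≥ 0 small enough that (a, a + √ε, c) ∈ U. Then: (i) the right derivative h'₊(0) := lim_{ε→0⁺} (h(ε) − h(0))/ε exists and equals (1/2)·∂²F/∂x₂²(p), and moreover lim_{ε→0⁺} h'(ε) = (1/2)·∂²F/∂x₂²(p); (ii) the second right derivative lim_{ε→0⁺} (h'(ε) − h'₊(0))/ε exists and equals (1/12)·∂⁴F/∂x₂⁴(p), and moreover lim_{ε→0⁺} h''(ε) = (1/12)·∂⁴F/∂x₂⁴(p). -/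

import Mathlib

open Set Filter

/-- Partial derivative of `G : (Fin 3 → ℝ) → ℝ` with respect to the second variable,
defined as the derivative of the slice `t ↦ G (x with second coordinate t)`. -/
noncomputable def pdy (G : (Fin 3 → ℝ) → ℝ) (x : Fin 3 → ℝ) : ℝ :=
  deriv (fun t : ℝ => G (Function.update x 1 t)) (x 1)

open Topology in
theorem aux_core (G0 G1 G2 G3 : ℝ → ℝ) (g4 : ℝ) (h : ℝ → ℝ)
    (d0 : ∀ᶠ s in 𝓝 (0:ℝ), HasDerivAt G0 (G1 s) s)
    (d1 : ∀ᶠ s in 𝓝 (0:ℝ), HasDerivAt G1 (G2 s) s)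
    (d2 : ∀ᶠ s in 𝓝 (0:ℝ), HasDerivAt G2 (G3 s) s)
    (d3 : HasDerivAt G3 g4 0)
    (z1 : G1 0 = 0) (z3 : G3 0 = 0)
    (hh : ∀ ε, h ε = G0 (Real.sqrt ε)) :
    (Tendsto (fun ε => (h ε - h 0) / ε) (𝓝[>] 0) (𝓝 ((1/2) * G2 0)) ∧
      Tendsto (fun ε => deriv h ε) (𝓝[>] 0) (𝓝 ((1/2) * G2 0))) ∧
    (Tendsto (fun ε => (deriv h ε - (1/2) * G2 0) / ε) (𝓝[>] 0) (𝓝 ((1/12) * g4)) ∧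
      Tendsto (fun ε => deriv (deriv h) ε) (𝓝[>] 0) (𝓝 ((1/12) * g4))) := by
  have c0 := d0.self_of_nhds.continuousAt
  have c1 := d1.self_of_nhds.continuousAt
  have c2 := d2.self_of_nhds.continuousAt
  have le : 𝓝[>] (0:ℝ) ≤ 𝓝 0 := nhdsWithin_le_nhds
  have pos : ∀ᶠ s in 𝓝[>] (0:ℝ), 0 < s := eventually_mem_nhdsWithin
  -- square root at zero from the right
  have hsq : Tendsto Real.sqrt (𝓝[>] (0:ℝ)) (𝓝[>] 0) := by
    refine tendsto_nhdsWithin_iff.2 ⟨?_, ?_⟩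
    · have := Real.continuous_sqrt.tendsto 0
      rw [Real.sqrt_zero] at this
      exact this.mono_left le
    · filter_upwards [pos] with s hs using Real.sqrt_pos.2 hs
  -- difference quotients of functions vanishing at zero
  have dq : ∀ (f : ℝ → ℝ) (f' : ℝ), HasDerivAt f f' 0 → f 0 = 0 →
      Tendsto (fun s => f s / s) (𝓝[>] 0) (𝓝 f') := by
    intro f f' hf h0
    have := (hasDerivAt_iff_tendsto_slope_zero.1 hf).mono_left
      (nhdsWithin_mono 0 (fun x (hx : (0:ℝ) < x) => ne_of_gt hx))
    refine this.congr (fun s => ?_)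
    simp [h0, div_eq_inv_mul]
  have q1 := dq G1 (G2 0) d1.self_of_nhds z1
  have q3 := dq G3 g4 d3 z3
  -- limits in s
  have L1 : Tendsto (fun s => (G0 s - G0 0) / s ^ 2) (𝓝[>] 0) (𝓝 ((1/2) * G2 0)) := by
    refine HasDerivAt.lhopital_zero_nhdsGT (f' := G1) (g' := fun s => 2 * s) ?_ ?_ ?_ ?_ ?_ ?_
    · filter_upwards [le d0] with s hs using hs.sub_const _
    · filter_upwards with s
      simpa using hasDerivAt_pow 2 s
    · filter_upwards [pos] with s hs
      positivity
    · have : ContinuousAt (fun s => G0 s - G0 0) 0 := by fun_prop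
      simpa using this.tendsto.mono_left le
    · have : ContinuousAt (fun s : ℝ => s ^ 2) 0 := by fun_prop
      simpa using this.tendsto.mono_left le
    · refine (q1.const_mul (1/2)).congr (fun s => ?_)
      ring_nf
  have L2 : Tendsto (fun s => G1 s / (2 * s)) (𝓝[>] 0) (𝓝 ((1/2) * G2 0)) := by
    refine (q1.const_mul (1/2)).congr (fun s => ?_)
    ring_nf
  have q3' : Tendsto (fun s => G3 s / (12 * s)) (𝓝[>] 0) (𝓝 ((1/12) * g4)) := by
    refine (q3.const_mul (1/12)).congr (fun s => ?_)
    ring_nf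
  have p3 : ∀ k : ℝ, ∀ s : ℝ, HasDerivAt (fun s : ℝ => k * s ^ 3) (k * (3 * s ^ 2)) s := by
    intro k s
    simpa using (hasDerivAt_pow 3 s).const_mul k
  have p2 : ∀ k : ℝ, ∀ s : ℝ, HasDerivAt (fun s : ℝ => k * s ^ 2) (k * (2 * s)) s := by
    intro k s
    simpa using (hasDerivAt_pow 2 s).const_mul k
  have L3a : Tendsto (fun s => (G2 s - G2 0) / (6 * s ^ 2)) (𝓝[>] 0) (𝓝 ((1/12) * g4)) := by
    refine HasDerivAt.lhopital_zero_nhdsGT (f' := G3) (g' := fun s => 6 * (2 * s)) ?_ ?_ ?_ ?_ ?_ ?_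
    · filter_upwards [le d2] with s hs using hs.sub_const _
    · filter_upwards with s using p2 6 s
    · filter_upwards [pos] with s hs
      positivity
    · have : ContinuousAt (fun s => G2 s - G2 0) 0 := by fun_prop
      simpa using this.tendsto.mono_left le
    · have : ContinuousAt (fun s : ℝ => 6 * s ^ 2) 0 := by fun_prop
      simpa using this.tendsto.mono_left le
    · refine q3'.congr (fun s => ?_)
      ring_nf
  have L3 : Tendsto (fun s => (G1 s - G2 0 * s) / (2 * s ^ 3)) (𝓝[>] 0) (𝓝 ((1/12) * g4)) := by
    refine HasDerivAt.lhopital_zero_nhdsGT (f' := fun s => G2 s - G2 0)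
      (g' := fun s => 2 * (3 * s ^ 2)) ?_ ?_ ?_ ?_ ?_ ?_
    · filter_upwards [le d1] with s hs
      refine (hs.sub ((hasDerivAt_id s).const_mul (G2 0))).congr_deriv ?_
      simp
    · filter_upwards with s using p3 2 s
    · filter_upwards [pos] with s hs
      positivity
    · have : ContinuousAt (fun s => G1 s - G2 0 * s) 0 := by fun_prop
      simpa [z1] using this.tendsto.mono_left le
    · have : ContinuousAt (fun s : ℝ => 2 * s ^ 3) 0 := by fun_prop
      simpa using this.tendsto.mono_left le
    · refine L3a.congr (fun s => ?_)
      ring_nf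
  have L4 : Tendsto (fun s => (s * G2 s - G1 s) / (4 * s ^ 3)) (𝓝[>] 0) (𝓝 ((1/12) * g4)) := by
    refine HasDerivAt.lhopital_zero_nhdsGT (f' := fun s => s * G3 s)
      (g' := fun s => 4 * (3 * s ^ 2)) ?_ ?_ ?_ ?_ ?_ ?_
    · filter_upwards [le d1, le d2] with s hs1 hs2
      refine (((hasDerivAt_id s).mul hs2).sub hs1).congr_deriv ?_
      simp
    · filter_upwards with s using p3 4 s
    · filter_upwards [pos] with s hs
      positivity
    · have : ContinuousAt (fun s => s * G2 s - G1 s) 0 := by fun_prop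
      simpa [z1] using this.tendsto.mono_left le
    · have : ContinuousAt (fun s : ℝ => 4 * s ^ 3) 0 := by fun_prop
      simpa using this.tendsto.mono_left le
    · refine q3'.congr' ?_
      filter_upwards [pos] with s hs
      field_simp
      ring
  -- derivatives of h
  have hfun : h = fun ε => G0 (Real.sqrt ε) := funext hh
  have D1 : ∀ᶠ ε in 𝓝[>] (0:ℝ), deriv h ε = G1 (Real.sqrt ε) / (2 * Real.sqrt ε) := by
    filter_upwards [hsq.eventually (le d0), pos] with ε h0 hε
    rw [hfun]
    have := h0.comp ε (Real.hasDerivAt_sqrt hε.ne')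
    refine this.deriv.trans ?_
    ring
  have D2 : ∀ᶠ ε in 𝓝[>] (0:ℝ), deriv (deriv h) ε =
      (Real.sqrt ε * G2 (Real.sqrt ε) - G1 (Real.sqrt ε)) / (4 * Real.sqrt ε ^ 3) := by
    have D1' := eventually_eventually_nhdsWithin.2 D1
    filter_upwards [hsq.eventually (le d1), pos, D1'] with ε h0 hε hD
    have hD' : deriv h =ᶠ[𝓝 ε] fun ε => G1 (Real.sqrt ε) / (2 * Real.sqrt ε) := by
      rwa [IsOpen.nhdsWithin_eq isOpen_Ioi hε] at hD
    rw [hD'.deriv_eq]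
    have hs := Real.hasDerivAt_sqrt hε.ne'
    have sp := Real.sqrt_pos.2 hε
    have := (h0.comp ε hs).div (hs.const_mul 2) (by positivity)
    refine this.deriv.trans ?_
    simp only [Function.comp_apply]
    field_simp
    try ring
  have S : ∀ᶠ ε in 𝓝[>] (0:ℝ), Real.sqrt ε ^ 2 = ε := by
    filter_upwards [pos] with ε hε using Real.sq_sqrt hε.le
  refine ⟨⟨?_, ?_⟩, ?_, ?_⟩
  · refine (L1.comp hsq).congr' ?_
    filter_upwards [S] with ε hS
    simp [hh, hS]
  · refine (L2.comp hsq).congr' ?_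
    filter_upwards [D1] with ε hD
    simp [hD]
  · refine (L3.comp hsq).congr' ?_
    filter_upwards [S, D1, pos] with ε hS hD hε
    have sp := Real.sqrt_pos.2 hε
    rw [hD]
    simp only [Function.comp_apply]
    nth_rewrite 6 [← hS]
    field_simp
  · refine (L4.comp hsq).congr' ?_
    filter_upwards [D2] with ε hD
    simp [hD]

open Topology in
theorem aux_slice (U : Set (Fin 3 → ℝ)) (hU : IsOpen U)
    (p : Fin 3 → ℝ) (hpU : p ∈ U) (K : (Fin 3 → ℝ) → ℝ)
    (hd : ∀ x ∈ U, DifferentiableAt ℝ (fun t : ℝ => K (Function.update x 1 t)) (x 1)) :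
    ∀ᶠ s in 𝓝 (0:ℝ), HasDerivAt (fun s => K (Function.update p 1 (p 1 + s)))
      (pdy K (Function.update p 1 (p 1 + s))) s := by
  have hc : ContinuousAt (fun s : ℝ => Function.update p 1 (p 1 + s)) 0 := by
    have : Continuous (fun s : ℝ => Function.update p 1 (p 1 + s)) :=
      continuous_const.update 1 (by fun_prop)
    exact this.continuousAt
  have hm : ∀ᶠ s in 𝓝 (0:ℝ), Function.update p 1 (p 1 + s) ∈ U := by
    apply hc.eventually
    simpa using hU.mem_nhds hpU
  filter_upwards [hm] with s hs
  have := (hd _ hs).hasDerivAt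
  simp only [Function.update_idem, Function.update_self] at this
  have h2 := this.comp_const_add (p 1) s
  refine h2.congr_deriv ?_
  simp [pdy]

/-- Lemma B.2 of the paper: for `F` which is `C²` on an open `U ∋ p = (a,a,c)` and whose
partial derivatives in the second variable up to order 5 exist and are continuous on `U`,
with `∂F/∂x₂ (p) = 0` and `∂³F/∂x₂³ (p) = 0`, the function `h ε = F (a, a + √ε, c)` is
continuously right-differentiable to second order at `0`, with
`h'₊(0) = (1/2) ∂²F/∂x₂² (p)` and second right derivative `(1/12) ∂⁴F/∂x₂⁴ (p)`. -/
theorem statement6 (U : Set (Fin 3 → ℝ)) (hU : IsOpen U)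
    (a c : ℝ) (p : Fin 3 → ℝ) (hp : p = ![a, a, c]) (hpU : p ∈ U)
    (F : (Fin 3 → ℝ) → ℝ) (hF : ContDiffOn ℝ 2 F U)
    (hdiff : ∀ k < 5, ∀ x ∈ U,
      DifferentiableAt ℝ (fun t : ℝ => (pdy^[k] F) (Function.update x 1 t)) (x 1))
    (hcont : ∀ k ≤ 5, ContinuousOn (pdy^[k] F) U)
    (h1 : pdy F p = 0) (h3 : pdy^[3] F p = 0)
    (h : ℝ → ℝ) (hh : ∀ ε : ℝ, h ε = F ![a, a + Real.sqrt ε, c]) :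
    (Tendsto (fun ε => (h ε - h 0) / ε) (nhdsWithin 0 (Ioi 0))
        (nhds ((1/2) * pdy^[2] F p)) ∧
      Tendsto (fun ε => deriv h ε) (nhdsWithin 0 (Ioi 0))
        (nhds ((1/2) * pdy^[2] F p))) ∧
    (Tendsto (fun ε => (deriv h ε - (1/2) * pdy^[2] F p) / ε) (nhdsWithin 0 (Ioi 0))
        (nhds ((1/12) * pdy^[4] F p)) ∧
      Tendsto (fun ε => deriv (deriv h) ε) (nhdsWithin 0 (Ioi 0))
        (nhds ((1/12) * pdy^[4] F p))) := by
  have hupd : ∀ s : ℝ, Function.update p 1 (p 1 + s) = ![a, a + s, c] := by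
    intro s
    subst hp
    ext i
    fin_cases i <;> simp
  have hp0 : Function.update p 1 (p 1 + 0) = p := by simp
  have key : ∀ k < 5, ∀ᶠ s in nhds (0:ℝ),
      HasDerivAt (fun s => (pdy^[k] F) (Function.update p 1 (p 1 + s)))
        ((pdy^[k+1] F) (Function.update p 1 (p 1 + s))) s := by
    intro k hk
    rw [Function.iterate_succ_apply']
    exact aux_slice U hU p hpU _ (hdiff k hk)
  have := aux_core (fun s => F (Function.update p 1 (p 1 + s)))
    (fun s => (pdy^[1] F) (Function.update p 1 (p 1 + s)))
    (fun s => (pdy^[2] F) (Function.update p 1 (p 1 + s)))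
    (fun s => (pdy^[3] F) (Function.update p 1 (p 1 + s))) (pdy^[4] F p) h
    (key 0 (by norm_num)) (key 1 (by norm_num)) (key 2 (by norm_num))
    (by simpa only [hp0] using (key 3 (by norm_num)).self_of_nhds)
    (by simpa only [hp0, Function.iterate_one] using h1) (by simpa only [hp0] using h3)
    (fun ε => by rw [hh, hupd])
  simpa only [hp0] using this
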